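/- Let 0 < p ≤ 1 and let (Φ_n)_{n≥1} be any nondecreasing sequence of positive reals with lim_{n→∞} Φ_n = +∞. Then there exists a martingale f ∈ H_p(G_m) such that Σ_{k=1}^∞ (Φ_{M_k} / M_k^{2/p−2}) Σ_{j=1}^{m_k−1} |f̂(j·M_k)|^2 = ∞. -/

import Mathlib

open MeasureTheory Filter Finset
open scoped Classical ENNReal NNReal

noncomputable section

namespace VilenkinPaper

/-- The generalized powers `M_0 = 1`, `M_{k+1} = m_k M_k`. -/
def Mseq (m : ℕ → ℕ) : ℕ → ℕ
  | 0 => 1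
  | k + 1 => m k * Mseq m k

/-- The Vilenkin group `G_m = ∏_k ℤ_{m_k}`. -/
abbrev Gm (m : ℕ → ℕ) : Type := (k : ℕ) → ZMod (m k)

/-- The `j`-th digit of `n` in the generalized number system based on `m`. -/
def digit (m : ℕ → ℕ) (n j : ℕ) : ℕ := n / Mseq m j % m j

/-- The generalized Rademacher functions `r_k(x) = exp(2πi x_k / m_k)`. -/
def rad (m : ℕ → ℕ) (k : ℕ) (x : Gm m) : ℂ :=
  Complex.exp (2 * Real.pi * Complex.I * ((x k).val : ℂ) / (m k : ℂ))

/-- The Vilenkin system `ψ_n = ∏_k r_k^{n_k}`. -/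
def psi (m : ℕ → ℕ) (n : ℕ) (x : Gm m) : ℂ := ∏ᶠ k : ℕ, rad m k x ^ digit m n k

/-- The Dirichlet kernels `D_n = ∑_{k<n} ψ_k`. -/
def Dker (m : ℕ → ℕ) (n : ℕ) (x : Gm m) : ℂ := ∑ k ∈ Finset.range n, psi m k x

/-- The interval `I_n(x)` : all `y` agreeing with `x` on the first `n` coordinates. -/
def Iset (m : ℕ → ℕ) (n : ℕ) (x : Gm m) : Set (Gm m) := {y | ∀ k < n, y k = x k}

/-- `I_n := I_n(0)`. -/
def IsetO (m : ℕ → ℕ) (n : ℕ) : Set (Gm m) := Iset m n 0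

/-- `μ` is the normalized Haar (product) measure iff every interval `I_n(x)` has
measure `1 / M_n`. -/
def IsHaarGm (m : ℕ → ℕ) (μ : Measure (Gm m)) : Prop :=
  ∀ n x, μ (Iset m n x) = ((Mseq m n : ℝ≥0∞))⁻¹

/-- The σ-algebra `F_n` generated by the intervals `{I_n(x)}`, i.e. by the first `n`
coordinates. -/
def filt (m : ℕ → ℕ) (n : ℕ) : MeasurableSpace (Gm m) :=
  MeasurableSpace.comap (fun x (k : Fin n) => x k) ⊤

/-- A (Vilenkin) martingale with respect to the filtration `F_n`. -/
def IsVMartingale (m : ℕ → ℕ) (μ : Measure (Gm m)) (f : ℕ → Gm m → ℂ) : Prop :=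
  (∀ n, Integrable (f n) μ) ∧
  (∀ n, Measurable[filt m n] (f n)) ∧
  (∀ n N, n ≤ N → μ[f N | filt m n] =ᵐ[μ] f n)

/-- Membership in the martingale Hardy space `H_p`: the maximal function
`f* = sup_n |f^{(n)}|` belongs to `L_p`. -/
def MemHp (m : ℕ → ℕ) (μ : Measure (Gm m)) (p : ℝ) (f : ℕ → Gm m → ℂ) : Prop :=
  ∫⁻ x, (⨆ n, (‖f n x‖₊ : ℝ≥0∞)) ^ p ∂μ < ⊤

/-- The `i`-th Vilenkin–Fourier coefficient of an integrable function. -/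
def fourierCoefFn (m : ℕ → ℕ) (μ : Measure (Gm m)) (g : Gm m → ℂ) (i : ℕ) : ℂ :=
  ∫ x, g x * (starRingEnd ℂ) (psi m i x) ∂μ

/-- The partial sum `S_n` built from a sequence `c` of Fourier coefficients. -/
def Spart (m : ℕ → ℕ) (c : ℕ → ℂ) (n : ℕ) (x : Gm m) : ℂ :=
  ∑ k ∈ Finset.range n, c k * psi m k x

/-- The weak `L_{p,∞}` quasinorm `sup_{λ>0} λ μ(|g| > λ)^{1/p}`. -/
def wLp (m : ℕ → ℕ) (μ : Measure (Gm m)) (p : ℝ) (g : Gm m → ℂ) : ℝ≥0∞ :=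
  ⨆ (t : ℝ) (_ : 0 < t), ENNReal.ofReal t * μ {x | t < ‖g x‖} ^ (1 / p)

/-- `|n| = max {j : n_j ≠ 0}`. -/
def maxDigit (m : ℕ → ℕ) (n : ℕ) : ℕ := sSup {j | digit m n j ≠ 0}

/-- The set `ℕ_{n_0}` of positive integers with `n_0 = n_{|n|} = 1`. -/
def Nn0 (m : ℕ → ℕ) : Set ℕ :=
  {n | 0 < n ∧ digit m n 0 = 1 ∧ digit m n (maxDigit m n) = 1}

/-- The atom `a = (M_α^{1/p-1}/M) (D_{M_{α+1}} - D_{M_α})`. -/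
def atomFun (m : ℕ → ℕ) (MM : ℕ) (p : ℝ) (a : ℕ) (x : Gm m) : ℂ :=
  (((Mseq m a : ℝ) ^ (1 / p - 1) / (MM : ℝ) : ℝ) : ℂ) *
    (Dker m (Mseq m (a + 1)) x - Dker m (Mseq m a) x)

/-- The coefficients `λ_k = Φ_{M_{α_k}}^{-1/4}`. -/
def lamSeq (m : ℕ → ℕ) (Φ : ℕ → ℝ) (α : ℕ → ℕ) (k : ℕ) : ℝ :=
  Φ (Mseq m (α k)) ^ (-(1 / 4 : ℝ))

/-- The martingale `f^{(A)} = ∑_{k : α_k < A} λ_k a_k` of the counterexample construction. -/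
def fCon (m : ℕ → ℕ) (MM : ℕ) (p : ℝ) (Φ : ℕ → ℝ) (α : ℕ → ℕ) (A : ℕ) (x : Gm m) : ℂ :=
  ∑ᶠ (k : ℕ) (_ : α k < A), (lamSeq m Φ α k : ℂ) * atomFun m MM p (α k) x

section Arithmetic

variable {m : ℕ → ℕ}

lemma Mseq_succ (k : ℕ) : Mseq m (k + 1) = m k * Mseq m k := rfl

lemma Mseq_pos [∀ k, NeZero (m k)] (n : ℕ) : 0 < Mseq m n := by
  induction n with
  | zero => simp [Mseq]
  | succ n ih => exact Nat.mul_pos (Nat.pos_of_ne_zero (NeZero.ne _)) ih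

lemma Mseq_dvd {a b : ℕ} (h : a ≤ b) : Mseq m a ∣ Mseq m b := by
  induction b, h using Nat.le_induction with
  | base => exact dvd_rfl
  | succ n _ ih => exact ih.trans (Dvd.intro_left _ rfl)

lemma Mseq_mono [∀ k, NeZero (m k)] : Monotone (Mseq m) :=
  fun _ _ h => Nat.le_of_dvd (Mseq_pos _) (Mseq_dvd h)

lemma lt_Mseq (hm : ∀ k, 2 ≤ m k) (n : ℕ) : n < Mseq m n := by
  induction n with
  | zero => simp [Mseq]
  | succ n ih =>
    rw [Mseq_succ]
    nlinarith [hm n]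

lemma digit_eq_zero_of_lt {i k : ℕ} (h : i < Mseq m k) : digit m i k = 0 := by
  simp [digit, Nat.div_eq_of_lt h]

lemma digit_mul_Mseq [∀ k, NeZero (m k)] {a j : ℕ} (hj : j < m a) (k : ℕ) :
    digit m (j * Mseq m a) k = if k = a then j else 0 := by
  rcases lt_trichotomy k a with h | rfl | h
  · obtain ⟨c, hc⟩ := Mseq_dvd (m := m) (Nat.succ_le_of_lt h)
    rw [if_neg h.ne, digit, hc, Nat.succ_eq_add_one, Mseq_succ,
      show j * (m k * Mseq m k * c) = (m k * (j * c)) * Mseq m k by ring,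
      Nat.mul_div_cancel _ (Mseq_pos _), Nat.mul_mod_right]
  · rw [if_pos rfl, digit, Nat.mul_div_cancel _ (Mseq_pos _), Nat.mod_eq_of_lt hj]
  · rw [if_neg h.ne']
    refine digit_eq_zero_of_lt (lt_of_lt_of_le ?_ (Mseq_mono (Nat.succ_le_of_lt h)))
    exact Nat.mul_lt_mul_of_pos_right hj (Mseq_pos _)

end Arithmetic

section Characters

variable {m : ℕ → ℕ}

lemma psi_eq_prod [∀ k, NeZero (m k)] {i n : ℕ} (h : i < Mseq m n) (x : Gm m) :
    psi m i x = ∏ k ∈ range n, rad m k x ^ digit m i k := by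
  refine finprod_eq_prod_of_mulSupport_subset _ fun k hk => ?_
  by_contra hkn
  rw [Finset.mem_coe, Finset.mem_range, not_lt] at hkn
  exact hk (by simp [digit_eq_zero_of_lt (h.trans_le (Mseq_mono hkn))])

lemma psi_mul_Mseq [∀ k, NeZero (m k)] {a j : ℕ} (hj : j < m a) (x : Gm m) :
    psi m (j * Mseq m a) x = rad m a x ^ j := by
  rw [psi, finprod_eq_single _ a]
  · simp [digit_mul_Mseq hj]
  · intro k hk
    simp [digit_mul_Mseq hj, hk]

lemma norm_rad (k : ℕ) (x : Gm m) : ‖rad m k x‖ = 1 := by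
  rw [rad, show 2 * (Real.pi : ℂ) * Complex.I * ((x k).val : ℂ) / (m k : ℂ)
    = ((2 * Real.pi * (x k).val / m k : ℝ) : ℂ) * Complex.I by push_cast; ring]
  exact Complex.norm_exp_ofReal_mul_I _

lemma measurable_rad (k : ℕ) : Measurable (rad m k) :=
  (measurable_from_top (f := fun v : ZMod (m k) =>
    Complex.exp (2 * Real.pi * Complex.I * (v.val : ℂ) / (m k : ℂ)))).comp (measurable_pi_apply k)

lemma norm_psi (hm : ∀ k, 2 ≤ m k) (i : ℕ) (x : Gm m) : ‖psi m i x‖ = 1 := by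
  have : ∀ k, NeZero (m k) := fun k => ⟨by have := hm k; omega⟩
  simp [psi_eq_prod (lt_Mseq hm i), norm_rad]

lemma measurable_psi (hm : ∀ k, 2 ≤ m k) (i : ℕ) : Measurable (psi m i) := by
  have : ∀ k, NeZero (m k) := fun k => ⟨by have := hm k; omega⟩
  rw [funext (psi_eq_prod (lt_Mseq hm i))]
  exact Finset.measurable_prod _ fun k _ => (measurable_rad k).pow_const _

lemma psi_eq_one [∀ k, NeZero (m k)] {i n : ℕ} (h : i < Mseq m n) {x : Gm m}
    (hx : x ∈ IsetO m n) : psi m i x = 1 := by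
  rw [psi_eq_prod h]
  refine Finset.prod_eq_one fun k hk => ?_
  have : x k = 0 := hx k (Finset.mem_range.1 hk)
  simp [rad, this]

lemma sum_zmod_exp_pow {N j : ℕ} [NeZero N] (hj1 : 1 ≤ j) (hj : j < N) :
    ∑ v : ZMod N, Complex.exp (2 * Real.pi * Complex.I * (v.val : ℂ) / (N : ℂ)) ^ j = 0 := by
  set ω : ℂ := Complex.exp (2 * Real.pi * Complex.I / (N : ℂ)) with hω
  have hprim : IsPrimitiveRoot ω N := Complex.isPrimitiveRoot_exp N (NeZero.ne N)
  have hne : ω ^ j ≠ 1 := hprim.pow_ne_one_of_pos_of_lt (by omega) hj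
  have hterm : ∀ v : ZMod N,
      Complex.exp (2 * Real.pi * Complex.I * (v.val : ℂ) / (N : ℂ)) ^ j = (ω ^ j) ^ v.val := by
    intro v
    rw [← pow_mul, mul_comm j, pow_mul, hω, ← Complex.exp_nat_mul _ v.val]
    congr 2
    ring
  calc _ = ∑ v : ZMod N, (ω ^ j) ^ v.val := Finset.sum_congr rfl fun v _ => hterm v
    _ = ∑ k ∈ range N, (ω ^ j) ^ k := by
      refine Finset.sum_nbij ZMod.val (fun v _ => Finset.mem_range.2 v.val_lt)
        (fun v _ w _ h => ZMod.val_injective N h) (fun k hk => ?_) fun _ _ => rfl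
      exact ⟨k, by simp, ZMod.val_cast_of_lt (by simpa using hk)⟩
    _ = 0 := by
      have h := mul_geom_sum (ω ^ j) N
      rw [← pow_mul, mul_comm j, pow_mul, hprim.pow_eq_one, one_pow, sub_self] at h
      exact (mul_eq_zero.1 h).resolve_left (sub_ne_zero.2 hne)

end Characters

section Intervals

variable {m : ℕ → ℕ}

lemma measurableSet_filt_Iset {a n : ℕ} (h : a ≤ n) (y : Gm m) :
    MeasurableSet[filt m n] (Iset m a y) :=
  ⟨{v | ∀ k (hk : k < a), v ⟨k, hk.trans_le h⟩ = y k}, trivial, rfl⟩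

lemma filt_mono {a n : ℕ} (h : a ≤ n) : filt m a ≤ filt m n := by
  rintro _ ⟨S, -, rfl⟩
  exact ⟨(fun v (k : Fin a) => v (Fin.castLE h k)) ⁻¹' S, trivial, rfl⟩

lemma filt_le [∀ k, NeZero (m k)] (n : ℕ) : filt m n ≤ MeasurableSpace.pi := by
  rintro _ ⟨S, -, rfl⟩
  have hmeas : Measurable fun (x : Gm m) (k : Fin n) => x k :=
    measurable_pi_lambda _ fun k => measurable_pi_apply _
  exact hmeas S.toFinite.measurableSet

lemma measurableSet_Iset [∀ k, NeZero (m k)] (n : ℕ) (y : Gm m) : MeasurableSet (Iset m n y) :=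
  filt_le n _ (measurableSet_filt_Iset le_rfl y)

lemma measurableSet_IsetO [∀ k, NeZero (m k)] (n : ℕ) : MeasurableSet (IsetO m n) :=
  measurableSet_Iset n 0

lemma Iset_anti {a n : ℕ} (h : a ≤ n) (y : Gm m) : Iset m n y ⊆ Iset m a y :=
  fun _ hx k hk => hx k (hk.trans_le h)

lemma exists_Iset_eq [∀ k, NeZero (m k)] (n : ℕ) (v : (k : Fin n) → ZMod (m k)) :
    ∃ y : Gm m, (fun (x : Gm m) (k : Fin n) => x k) ⁻¹' ({v} : Set _) = Iset m n y := by
  refine ⟨fun k => if h : k < n then v ⟨k, h⟩ else 0, ?_⟩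
  ext x
  simp only [Set.mem_preimage, Set.mem_singleton_iff, funext_iff, Fin.forall_iff, Iset,
    Set.mem_ofPred_eq]
  refine forall₂_congr fun k hk => ?_
  rw [dif_pos hk]

lemma Iset_eq_iUnion (n : ℕ) (y : Gm m) :
    Iset m n y = ⋃ v : ZMod (m n), Iset m (n + 1) (Function.update y n v) := by
  ext x
  simp only [Set.mem_iUnion]
  constructor
  · intro hx
    refine ⟨x n, fun k hk => ?_⟩
    rcases Nat.lt_succ_iff_lt_or_eq.1 hk with h | rfl
    · rw [Function.update_of_ne h.ne]
      exact hx k h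
    · simp
  · rintro ⟨v, hx⟩ k hk
    rw [hx k (by omega), Function.update_of_ne hk.ne]

/-- A function with vanishing integrals over the intervals of order `a` has vanishing integrals
over all `F_a`-measurable sets. -/
lemma setIntegral_eq_zero_of_Iset [∀ k, NeZero (m k)] {μ : Measure (Gm m)} {a : ℕ}
    {h : Gm m → ℂ} (hint : Integrable h μ) (hzero : ∀ y, ∫ x in Iset m a y, h x ∂μ = 0)
    {s : Set (Gm m)} (hs : MeasurableSet[filt m a] s) : ∫ x in s, h x ∂μ = 0 := by
  obtain ⟨S, -, rfl⟩ := hs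
  have hfin : S.Finite := S.toFinite
  have hcover : (fun (x : Gm m) (k : Fin a) => x k) ⁻¹' S
      = ⋃ v ∈ hfin.toFinset, (fun (x : Gm m) (k : Fin a) => x k) ⁻¹' {v} := by
    ext x
    simp
  rw [hcover, integral_biUnion_finset]
  · refine Finset.sum_eq_zero fun v _ => ?_
    obtain ⟨y, hy⟩ := exists_Iset_eq a v
    rw [hy, hzero]
  · exact fun v _ => filt_le a _ ⟨{v}, trivial, rfl⟩
  · exact fun v _ w _ hvw =>
      Set.disjoint_left.2 fun x hx hx' => hvw ((Set.mem_singleton_iff.1 hx).symm.trans hx')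
  · exact fun v _ => hint.integrableOn

end Intervals

section Haar

variable {m : ℕ → ℕ} {μ : Measure (Gm m)}

lemma IsHaarGm.isProbabilityMeasure (hμ : IsHaarGm m μ) : IsProbabilityMeasure μ := by
  refine ⟨?_⟩
  have h := hμ 0 0
  rwa [show Iset m 0 0 = Set.univ by ext; simp [Iset], Mseq, Nat.cast_one, inv_one] at h

lemma IsHaarGm.measureReal_Iset (hμ : IsHaarGm m μ) (n : ℕ) (y : Gm m) :
    μ.real (Iset m n y) = (Mseq m n : ℝ)⁻¹ := by
  simp [Measure.real, hμ n y]

/-- The normalized indicator `M_n 1_{I_n}`, which is the Dirichlet kernel `D_{M_n}`. -/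
def normInd (m : ℕ → ℕ) (n : ℕ) : Gm m → ℂ := (IsetO m n).indicator fun _ => (Mseq m n : ℂ)

lemma measurable_filt_normInd {a n : ℕ} (h : a ≤ n) : Measurable[filt m n] (normInd m a) :=
  Measurable.indicator (@measurable_const _ _ _ (filt m n) _) (measurableSet_filt_Iset h 0)

variable [∀ k, NeZero (m k)]

lemma integrable_normInd [IsFiniteMeasure μ] (n : ℕ) : Integrable (normInd m n) μ :=
  (integrable_const _).indicator (measurableSet_IsetO n)

lemma integrable_normInd_sub [IsFiniteMeasure μ] (a : ℕ) :
    Integrable (fun x => normInd m (a + 1) x - normInd m a x) μ :=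
  (integrable_normInd _).sub (integrable_normInd _)

lemma setIntegral_Iset_normInd (hμ : IsHaarGm m μ) {a n : ℕ} (h : a ≤ n) (y : Gm m) :
    ∫ x in Iset m a y, normInd m n x ∂μ = if y ∈ IsetO m a then 1 else 0 := by
  have hM : (Mseq m n : ℂ) ≠ 0 := by exact_mod_cast (Mseq_pos n).ne'
  rw [normInd, setIntegral_indicator (measurableSet_IsetO n), setIntegral_const]
  split_ifs with hy
  · have hsub : Iset m a y ∩ IsetO m n = Iset m n 0 := by
      refine Set.inter_eq_right.2 fun x hx k hk => ?_
      rw [hx k (hk.trans_le h), hy k hk]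
    rw [hsub, hμ.measureReal_Iset]
    simp [hM]
  · have hempty : Iset m a y ∩ IsetO m n = ∅ := by
      refine Set.eq_empty_iff_forall_notMem.2 fun x hx => hy fun k hk => ?_
      rw [← hx.1 k hk, hx.2 k (hk.trans_le h)]
    simp [hempty]

lemma setIntegral_normInd_sub (hμ : IsHaarGm m μ) {a : ℕ} {s : Set (Gm m)}
    (hs : MeasurableSet[filt m a] s) :
    ∫ x in s, (normInd m (a + 1) x - normInd m a x) ∂μ = 0 := by
  have := hμ.isProbabilityMeasure
  refine setIntegral_eq_zero_of_Iset (integrable_normInd_sub a) (fun y => ?_) hs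
  rw [integral_sub (integrable_normInd _).integrableOn (integrable_normInd _).integrableOn,
    setIntegral_Iset_normInd hμ (Nat.le_succ a), setIntegral_Iset_normInd hμ le_rfl, sub_self]

lemma setIntegral_Iset_rad_pow (hμ : IsHaarGm m μ) {a j : ℕ} (hj1 : 1 ≤ j) (hj : j < m a)
    (y : Gm m) : ∫ x in Iset m a y, rad m a x ^ j ∂μ = 0 := by
  have := hμ.isProbabilityMeasure
  have hint : Integrable (fun x => rad m a x ^ j) μ :=
    Integrable.of_bound ((measurable_rad a).pow_const j).aestronglyMeasurable 1
      (Eventually.of_forall fun x => by simp [norm_rad])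
  rw [Iset_eq_iUnion, integral_iUnion_fintype (fun v => measurableSet_Iset _ _) _
    fun v => hint.integrableOn]
  · have hpiece : ∀ v : ZMod (m a),
        ∫ x in Iset m (a + 1) (Function.update y a v), rad m a x ^ j ∂μ
        = ((Mseq m (a + 1) : ℝ)⁻¹ : ℝ) *
          Complex.exp (2 * Real.pi * Complex.I * (v.val : ℂ) / (m a : ℂ)) ^ j := by
      intro v
      rw [setIntegral_congr_fun (g := fun _ =>
        Complex.exp (2 * Real.pi * Complex.I * (v.val : ℂ) / (m a : ℂ)) ^ j)
        (measurableSet_Iset _ _), setIntegral_const, hμ.measureReal_Iset, Complex.real_smul]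
      intro x hx
      have hxa : x a = v := by simpa using hx a (Nat.lt_succ_self a)
      simp [rad, hxa]
    rw [Finset.sum_congr rfl fun v _ => hpiece v, ← Finset.mul_sum, sum_zmod_exp_pow hj1 hj,
      mul_zero]
  · intro v w hvw
    refine Set.disjoint_left.2 fun x hx hx' => hvw ?_
    have h1 : x a = v := by simpa using hx a (Nat.lt_succ_self a)
    have h2 : x a = w := by simpa using hx' a (Nat.lt_succ_self a)
    exact h1.symm.trans h2

lemma fourierCoefFn_normInd (n i : ℕ) :
    fourierCoefFn m μ (normInd m n) i
      = Mseq m n * ∫ x in IsetO m n, (starRingEnd ℂ) (psi m i x) ∂μ := by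
  rw [fourierCoefFn, ← integral_const_mul, ← integral_indicator (measurableSet_IsetO n)]
  refine integral_congr_ae (Eventually.of_forall fun x => ?_)
  by_cases hx : x ∈ IsetO m n
  · simp [normInd, hx]
  · simp [normInd, hx]

lemma fourierCoefFn_normInd_eq_one (hμ : IsHaarGm m μ) {n i : ℕ} (h : i < Mseq m n) :
    fourierCoefFn m μ (normInd m n) i = 1 := by
  have hM : (Mseq m n : ℂ) ≠ 0 := by exact_mod_cast (Mseq_pos n).ne'
  rw [fourierCoefFn_normInd, setIntegral_congr_fun (g := fun _ => 1) (measurableSet_IsetO n)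
    fun x hx => by simp [psi_eq_one h hx], setIntegral_const, IsetO, hμ.measureReal_Iset]
  simp [hM]

lemma fourierCoefFn_normInd_eq_zero (hμ : IsHaarGm m μ) {n a j : ℕ} (hj1 : 1 ≤ j)
    (hj : j < m a) (h : n ≤ a) : fourierCoefFn m μ (normInd m n) (j * Mseq m a) = 0 := by
  have := hμ.isProbabilityMeasure
  have hint : Integrable (fun x => rad m a x ^ j) μ :=
    Integrable.of_bound ((measurable_rad a).pow_const j).aestronglyMeasurable 1
      (Eventually.of_forall fun x => by simp [norm_rad])
  rw [fourierCoefFn_normInd, integral_conj]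
  simp_rw [psi_mul_Mseq hj]
  rw [IsetO, setIntegral_eq_zero_of_Iset hint (setIntegral_Iset_rad_pow hμ hj1 hj)
    (measurableSet_filt_Iset h 0), map_zero, mul_zero]

end Haar

section VilenkinMartingale

variable {m : ℕ → ℕ} {μ : Measure (Gm m)}

/-- The martingale `∑_{a < n} g_a (D_{M_{a+1}} - D_{M_a})`. -/
def kernelMartingale (m : ℕ → ℕ) (g : ℕ → ℝ) (n : ℕ) (x : Gm m) : ℂ :=
  ∑ a ∈ range n, (g a : ℂ) * (normInd m (a + 1) x - normInd m a x)

lemma measurable_filt_kernelMartingale (g : ℕ → ℝ) (n : ℕ) :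
    Measurable[filt m n] (kernelMartingale m g n) := by
  refine Finset.measurable_sum _ fun a ha => ?_
  have han := Finset.mem_range.1 ha
  exact ((measurable_filt_normInd han).sub (measurable_filt_normInd han.le)).const_mul _

variable [∀ k, NeZero (m k)] (g : ℕ → ℝ)

lemma integrable_kernelMartingale [IsFiniteMeasure μ] (n : ℕ) :
    Integrable (kernelMartingale m g n) μ :=
  integrable_finsetSum _ fun a _ =>
    (integrable_normInd_sub a).const_mul _

lemma setIntegral_kernelMartingale (hμ : IsHaarGm m μ) {n N : ℕ} (h : n ≤ N) {s : Set (Gm m)}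
    (hs : MeasurableSet[filt m n] s) :
    ∫ x in s, kernelMartingale m g N x ∂μ = ∫ x in s, kernelMartingale m g n x ∂μ := by
  have := hμ.isProbabilityMeasure
  induction N, h using Nat.le_induction with
  | base => rfl
  | succ N hN ih =>
    rw [← ih]
    have hstep : kernelMartingale m g (N + 1) = fun x => kernelMartingale m g N x
        + (g N : ℂ) * (normInd m (N + 1) x - normInd m N x) :=
      funext fun x => Finset.sum_range_succ _ N
    rw [hstep, integral_add (integrable_kernelMartingale g N).integrableOn
      ((integrable_normInd_sub N).const_mul _).integrableOn, integral_const_mul,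
      setIntegral_normInd_sub hμ (filt_mono hN s hs), mul_zero, add_zero]

lemma isVMartingale_kernelMartingale (hμ : IsHaarGm m μ) :
    IsVMartingale m μ (kernelMartingale m g) := by
  have := hμ.isProbabilityMeasure
  refine ⟨integrable_kernelMartingale g, measurable_filt_kernelMartingale g, fun n N h => ?_⟩
  exact (ae_eq_condExp_of_forall_setIntegral_eq (filt_le n) (integrable_kernelMartingale g N)
    (fun s _ _ => (integrable_kernelMartingale g n).integrableOn)
    (fun s hs _ => (setIntegral_kernelMartingale g hμ h hs).symm)
    (measurable_filt_kernelMartingale g n).stronglyMeasurable.aestronglyMeasurable).symm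

lemma fourierCoefFn_kernelMartingale (hm : ∀ k, 2 ≤ m k) [IsFiniteMeasure μ] (n i : ℕ) :
    fourierCoefFn m μ (kernelMartingale m g n) i = ∑ a ∈ range n, (g a : ℂ) *
      (fourierCoefFn m μ (normInd m (a + 1)) i - fourierCoefFn m μ (normInd m a) i) := by
  have hint : ∀ a, Integrable (fun x => normInd m a x * (starRingEnd ℂ) (psi m i x)) μ :=
    fun a => (integrable_normInd a).mul_bdd (c := 1)
      (Complex.continuous_conj.measurable.comp (measurable_psi hm i)).aestronglyMeasurable
      (Eventually.of_forall fun x => by simp [norm_psi hm])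
  simp only [fourierCoefFn, kernelMartingale, Finset.sum_mul, mul_assoc, sub_mul]
  have hsub : ∀ a, Integrable (fun x => normInd m (a + 1) x * (starRingEnd ℂ) (psi m i x)
      - normInd m a x * (starRingEnd ℂ) (psi m i x)) μ := fun a => (hint _).sub (hint _)
  rw [integral_finsetSum _ fun a _ => (hsub a).const_mul _]
  refine Finset.sum_congr rfl fun a _ => ?_
  rw [integral_const_mul, integral_sub (hint _) (hint _)]

lemma tendsto_fourierCoefFn_kernelMartingale (hm : ∀ k, 2 ≤ m k) (hμ : IsHaarGm m μ) (i : ℕ) :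
    Tendsto (fun n => fourierCoefFn m μ (kernelMartingale m g n) i) atTop
      (nhds (fourierCoefFn m μ (kernelMartingale m g i) i)) := by
  have := hμ.isProbabilityMeasure
  refine tendsto_atTop_of_eventually_const (i₀ := i) fun n hn => ?_
  rw [fourierCoefFn_kernelMartingale g hm, fourierCoefFn_kernelMartingale g hm]
  refine (Finset.sum_subset (Finset.range_mono hn) fun a _ ha => ?_).symm
  have hia : i < Mseq m a :=
    (lt_Mseq hm i).trans_le (Mseq_mono (by simpa using ha))
  rw [fourierCoefFn_normInd_eq_one hμ hia,
    fourierCoefFn_normInd_eq_one hμ (hia.trans_le (Mseq_mono a.le_succ)), sub_self, mul_zero]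

lemma fourierCoefFn_kernelMartingale_mul_Mseq (hm : ∀ k, 2 ≤ m k) (hμ : IsHaarGm m μ)
    {n a j : ℕ} (hj1 : 1 ≤ j) (hj : j < m a) (han : a < n) :
    fourierCoefFn m μ (kernelMartingale m g n) (j * Mseq m a) = g a := by
  have := hμ.isProbabilityMeasure
  have hlt : ∀ b, a < b → j * Mseq m a < Mseq m b := fun b hb =>
    (Nat.mul_lt_mul_of_pos_right hj (Mseq_pos _)).trans_le (Mseq_mono (m := m) hb)
  rw [fourierCoefFn_kernelMartingale g hm, Finset.sum_eq_single a]
  · rw [fourierCoefFn_normInd_eq_one hμ (hlt _ a.lt_succ_self),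
      fourierCoefFn_normInd_eq_zero hμ hj1 hj le_rfl, sub_zero, mul_one]
  · intro b _ hb
    rcases hb.lt_or_gt with h | h
    · rw [fourierCoefFn_normInd_eq_zero hμ hj1 hj h,
        fourierCoefFn_normInd_eq_zero hμ hj1 hj h.le, sub_zero, mul_zero]
    · rw [fourierCoefFn_normInd_eq_one hμ (hlt _ h),
        fourierCoefFn_normInd_eq_one hμ (hlt _ (h.trans b.lt_succ_self)), sub_self, mul_zero]
  · intro h
    exact absurd (Finset.mem_range.2 han) h

end VilenkinMartingale

section Hardy

variable {m : ℕ → ℕ} {μ : Measure (Gm m)}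

lemma ennreal_rpow_sum_le_sum_rpow {ι : Type*} (s : Finset ι) (f : ι → ℝ≥0∞) {p : ℝ}
    (hp0 : 0 < p) (hp1 : p ≤ 1) : (∑ i ∈ s, f i) ^ p ≤ ∑ i ∈ s, f i ^ p := by
  induction s using Finset.induction_on with
  | empty => simp [hp0]
  | insert a s ha ih =>
    rw [Finset.sum_insert ha, Finset.sum_insert ha]
    exact (ENNReal.rpow_add_le_add_rpow _ _ hp0.le hp1).trans (by gcongr)

lemma nnnorm_normInd_sub_le [∀ k, NeZero (m k)] (a : ℕ) (x : Gm m) :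
    (‖normInd m (a + 1) x - normInd m a x‖₊ : ℝ≥0∞)
      ≤ (IsetO m a).indicator (fun _ => (Mseq m (a + 1) : ℝ≥0∞)) x := by
  have hle : Mseq m a ≤ Mseq m (a + 1) := Mseq_mono a.le_succ
  by_cases hx : x ∈ IsetO m a
  · rw [Set.indicator_of_mem hx, ← ENNReal.coe_natCast, ENNReal.coe_le_coe, ← NNReal.coe_le_coe,
      coe_nnnorm, NNReal.coe_natCast]
    by_cases hx' : x ∈ IsetO m (a + 1)
    · rw [normInd, normInd, Set.indicator_of_mem hx, Set.indicator_of_mem hx', ← Nat.cast_sub hle,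
        Complex.norm_natCast]
      exact_mod_cast Nat.sub_le _ _
    · rw [normInd, normInd, Set.indicator_of_mem hx, Set.indicator_of_notMem hx', zero_sub,
        norm_neg, Complex.norm_natCast]
      exact_mod_cast hle
  · have hx' : x ∉ IsetO m (a + 1) := fun h => hx (Iset_anti a.le_succ 0 h)
    simp [normInd, hx, hx']

lemma memHp_kernelMartingale [∀ k, NeZero (m k)] (hμ : IsHaarGm m μ) {p : ℝ} (hp0 : 0 < p)
    (hp1 : p ≤ 1) {MM : ℕ} (hMM : ∀ k, m k ≤ MM) {b : ℕ → ℝ} (hb0 : ∀ a, 0 ≤ b a)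
    (hb : Summable fun a => b a ^ p) :
    MemHp m μ p (kernelMartingale m fun a => b a * (Mseq m a : ℝ) ^ (1 / p - 1)) := by
  set g : ℕ → ℝ := fun a => b a * (Mseq m a : ℝ) ^ (1 / p - 1) with hg
  have hg0 : ∀ a, 0 ≤ g a := fun a => mul_nonneg (hb0 a) (by positivity)
  set F : ℕ → Gm m → ℝ≥0∞ := fun a =>
    (IsetO m a).indicator fun _ => ENNReal.ofReal ((g a * Mseq m (a + 1)) ^ p) with hF
  have hpoint : ∀ x, (⨆ n, (‖kernelMartingale m g n x‖₊ : ℝ≥0∞)) ^ p ≤ ∑' a, F a x := by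
    intro x
    rw [← ENNReal.le_rpow_inv_iff hp0]
    refine iSup_le fun n => ?_
    rw [ENNReal.le_rpow_inv_iff hp0]
    calc (‖kernelMartingale m g n x‖₊ : ℝ≥0∞) ^ p
        ≤ (∑ a ∈ range n, (‖(g a : ℂ) * (normInd m (a + 1) x - normInd m a x)‖₊ : ℝ≥0∞)) ^ p := by
          gcongr
          rw [← ENNReal.ofNNReal_finsetSum]
          exact ENNReal.coe_le_coe.2 (nnnorm_sum_le _ _)
      _ ≤ ∑ a ∈ range n, (‖(g a : ℂ) * (normInd m (a + 1) x - normInd m a x)‖₊ : ℝ≥0∞) ^ p :=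
          ennreal_rpow_sum_le_sum_rpow _ _ hp0 hp1
      _ ≤ ∑ a ∈ range n, F a x := by
          refine Finset.sum_le_sum fun a _ => ?_
          have h := nnnorm_normInd_sub_le (m := m) a x
          have hga : (‖(g a : ℂ)‖₊ : ℝ≥0∞) = ENNReal.ofReal (g a) := by
            rw [← enorm_eq_nnnorm, ← ofReal_norm, Complex.norm_real,
              Real.norm_of_nonneg (hg0 a)]
          rw [nnnorm_mul, ENNReal.coe_mul, hga]
          by_cases hx : x ∈ IsetO m a
          · simp only [hF, Set.indicator_of_mem hx] at h ⊢
            rw [← ENNReal.ofReal_rpow_of_nonneg (mul_nonneg (hg0 a) (Nat.cast_nonneg _)) hp0.le,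
              ENNReal.ofReal_mul (hg0 a), ENNReal.ofReal_natCast]
            gcongr
          · simp only [hF, Set.indicator_of_notMem hx, nonpos_iff_eq_zero] at h ⊢
            rw [h, mul_zero, ENNReal.zero_rpow_of_pos hp0]
      _ ≤ ∑' a, F a x := ENNReal.sum_le_tsum _
  have hterm : ∀ a, ∫⁻ x, F a x ∂μ ≤ ENNReal.ofReal (b a ^ p * (MM : ℝ) ^ p) := by
    intro a
    have hMa : (0 : ℝ) < Mseq m a := by exact_mod_cast Mseq_pos a
    simp only [hF]
    rw [lintegral_indicator_const (measurableSet_IsetO a), IsetO, hμ a 0,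
      ← ENNReal.ofReal_natCast (Mseq m a), ← ENNReal.ofReal_inv_of_pos hMa,
      ← ENNReal.ofReal_mul (Real.rpow_nonneg (mul_nonneg (hg0 a) (Nat.cast_nonneg _)) _)]
    refine ENNReal.ofReal_le_ofReal ?_
    have hcancel : ((Mseq m a : ℝ) ^ (1 / p - 1) * Mseq m a) ^ p = Mseq m a := by
      rw [← Real.rpow_add_one hMa.ne', sub_add_cancel, ← Real.rpow_mul hMa.le,
        one_div_mul_cancel hp0.ne', Real.rpow_one]
    have hsplit : g a * (Mseq m (a + 1) : ℝ)
        = b a * m a * ((Mseq m a : ℝ) ^ (1 / p - 1) * Mseq m a) := by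
      rw [Mseq_succ, hg]
      push_cast
      ring
    rw [hsplit, Real.mul_rpow (mul_nonneg (hb0 a) (Nat.cast_nonneg _)) (by positivity), hcancel,
      mul_assoc, mul_inv_cancel₀ hMa.ne', mul_one, Real.mul_rpow (hb0 a) (Nat.cast_nonneg _)]
    have := hMM a
    have := Real.rpow_nonneg (hb0 a) p
    gcongr
  calc ∫⁻ x, (⨆ n, (‖kernelMartingale m g n x‖₊ : ℝ≥0∞)) ^ p ∂μ
      ≤ ∫⁻ x, ∑' a, F a x ∂μ := lintegral_mono hpoint
    _ = ∑' a, ∫⁻ x, F a x ∂μ :=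
        lintegral_tsum fun a => (measurable_const.indicator (measurableSet_IsetO a)).aemeasurable
    _ ≤ ∑' a, ENNReal.ofReal (b a ^ p * (MM : ℝ) ^ p) := ENNReal.tsum_le_tsum hterm
    _ < ⊤ := (hb.mul_right _).tsum_ofReal_lt_top

end Hardy

/-- Sparse `ℓ^p` weights that do not decay against a sequence tending to infinity. -/
lemma exists_weights {u : ℕ → ℝ} (hu : Tendsto u atTop atTop) {p : ℝ} (hp : 0 < p) :
    ∃ b : ℕ → ℝ, (∀ a, 0 ≤ b a) ∧ (Summable fun a => b a ^ p) ∧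
      ∃ᶠ a in atTop, 1 ≤ u a * b a ^ 2 := by
  set w : ℕ → ℝ := fun k => ((1 / 2 : ℝ) ^ k) ^ (1 / p) with hw
  have hw0 : ∀ k, 0 < w k := fun k => by positivity
  obtain ⟨α, hα, hαu⟩ := extraction_forall_of_eventually
    fun k => hu.eventually_ge_atTop ((w k ^ 2)⁻¹)
  have hext : ∀ k, Function.extend α w 0 (α k) = w k := hα.injective.extend_apply w 0
  refine ⟨Function.extend α w 0, fun a => ?_, ?_, ?_⟩
  · by_cases ha : ∃ k, α k = a
    · obtain ⟨k, rfl⟩ := ha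
      rw [hext]
      exact (hw0 k).le
    · simp [Function.extend_apply' _ _ _ ha]
  · refine (hα.injective.summable_iff fun a ha => ?_).1 ?_
    · rw [Function.extend_apply' _ _ _ ha, Pi.zero_apply, Real.zero_rpow hp.ne']
    · refine (summable_geometric_two).congr fun k => ?_
      rw [Function.comp_apply, hext, hw, ← Real.rpow_mul (by positivity),
        one_div_mul_cancel hp.ne', Real.rpow_one]
  · refine hα.tendsto_atTop.frequently (Frequently.of_forall fun k => ?_)
    rw [hext]
    have := hw0 k
    calc (1 : ℝ) = (w k ^ 2)⁻¹ * w k ^ 2 := (inv_mul_cancel₀ (by positivity)).symm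
      _ ≤ u (α k) * w k ^ 2 := by gcongr; exact hαu k

lemma tsum_eq_top_of_frequently_one_le {f : ℕ → ℝ≥0∞} (h : ∃ᶠ k in atTop, 1 ≤ f k) :
    ∑' k, f k = ⊤ := by
  by_contra hne
  have hlt := (ENNReal.tendsto_atTop_zero_of_tsum_ne_top hne).eventually_lt_const
    (zero_lt_one (α := ℝ≥0∞))
  obtain ⟨k, hk1, hk2⟩ := (h.and_eventually hlt).exists
  exact hk2.not_ge hk1

theorem statement1 (m : ℕ → ℕ) (hm : ∀ k, 2 ≤ m k)
    (MM : ℕ) (hMM : IsLUB (Set.range m) MM)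
    (μ : Measure (Gm m)) (hμ : IsHaarGm m μ)
    (p : ℝ) (hp0 : 0 < p) (hp1 : p ≤ 1)
    (Φ : ℕ → ℝ) (hΦpos : ∀ n, 0 < Φ n) (hΦmono : Monotone Φ)
    (hΦtop : Tendsto Φ atTop atTop) :
    ∃ (f : ℕ → Gm m → ℂ) (c : ℕ → ℂ),
      IsVMartingale m μ f ∧ MemHp m μ p f ∧
      (∀ i, Tendsto (fun k => fourierCoefFn m μ (f k) i) atTop (nhds (c i))) ∧
      ∑' k : ℕ, ENNReal.ofReal (Φ (Mseq m (k + 1)) / (Mseq m (k + 1) : ℝ) ^ (2 / p - 2) *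
        ∑ j ∈ Finset.Ico 1 (m (k + 1)), ‖c (j * Mseq m (k + 1))‖ ^ 2) = ⊤ := by
  have : ∀ k, NeZero (m k) := fun k => ⟨by have := hm k; omega⟩
  have hMtop : Tendsto (fun k => Mseq m (k + 1)) atTop atTop :=
    tendsto_atTop_mono (fun k => k.le_succ.trans (lt_Mseq hm (k + 1)).le) tendsto_id
  have hM : Tendsto (Mseq m) atTop atTop := (tendsto_add_atTop_iff_nat 1).1 hMtop
  obtain ⟨b, hb0, hb, hfreq⟩ := exists_weights (hΦtop.comp hM) hp0
  set g : ℕ → ℝ := fun a => b a * (Mseq m a : ℝ) ^ (1 / p - 1) with hg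
  refine ⟨kernelMartingale m g, fun i => fourierCoefFn m μ (kernelMartingale m g i) i,
    isVMartingale_kernelMartingale g hμ,
    memHp_kernelMartingale hμ hp0 hp1 (fun k => hMM.1 ⟨k, rfl⟩) hb0 hb,
    tendsto_fourierCoefFn_kernelMartingale g hm hμ, tsum_eq_top_of_frequently_one_le ?_⟩
  have hfreq' : ∃ᶠ k in atTop, 1 ≤ (Φ ∘ Mseq m) (k + 1) * b (k + 1) ^ 2 := by
    rw [← map_add_atTop_eq_nat 1] at hfreq
    exact hfreq
  refine hfreq'.mono fun k hk => ?_
  rw [← ENNReal.ofReal_one]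
  refine ENNReal.ofReal_le_ofReal (hk.trans ?_)
  have hMpos : (0 : ℝ) < Mseq m (k + 1) := by exact_mod_cast Mseq_pos (k + 1)
  have hcoef : ∀ j ∈ Finset.Ico 1 (m (k + 1)),
      ‖fourierCoefFn m μ (kernelMartingale m g (j * Mseq m (k + 1))) (j * Mseq m (k + 1))‖ ^ 2
        = b (k + 1) ^ 2 * (Mseq m (k + 1) : ℝ) ^ (2 / p - 2) := by
    intro j hj
    obtain ⟨hj1, hj2⟩ := Finset.mem_Ico.1 hj
    have hlt : k + 1 < j * Mseq m (k + 1) :=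
      (lt_Mseq hm (k + 1)).trans_le (Nat.le_mul_of_pos_left _ hj1)
    rw [fourierCoefFn_kernelMartingale_mul_Mseq g hm hμ hj1 hj2 hlt, Complex.norm_real,
      Real.norm_eq_abs, sq_abs, hg, mul_pow, ← Real.rpow_mul_natCast hMpos.le]
    congr 2
    push_cast
    ring
  have hcard : (1 : ℝ) ≤ (m (k + 1) - 1 : ℕ) := by
    have := hm (k + 1)
    exact_mod_cast (by omega : 1 ≤ m (k + 1) - 1)
  have hR : (0 : ℝ) < (Mseq m (k + 1) : ℝ) ^ (2 / p - 2) := by positivity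
  rw [Finset.sum_congr rfl hcoef, Finset.sum_const, Nat.card_Ico, nsmul_eq_mul]
  calc (Φ ∘ Mseq m) (k + 1) * b (k + 1) ^ 2
      = 1 * (Φ (Mseq m (k + 1)) * b (k + 1) ^ 2) := (one_mul _).symm
    _ ≤ (m (k + 1) - 1 : ℕ) * (Φ (Mseq m (k + 1)) * b (k + 1) ^ 2) := by
        have := (hΦpos (Mseq m (k + 1))).le
        gcongr
    _ = _ := by field_simp

end VilenkinPaper
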